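/- Let G be a finite simple graph with n vertices, m edges, degree sequence d_1, ..., d_n, and η triangles. Then the signless Laplacian Estrada index satisfies SLEE(G) ≥ n + 3m + η + Σ_{i=1}^n d_i² + (1/6)·Σ_{i=1}^n d_i³. (This is the paper's Theorem 4.1 in the case r = 2, where the right-hand side equals Σ_{k=0}^{3} Tr(Q^k)/k!.) -/

import Mathlib

open Finset Matrix

namespace Matrix.IsHermitian

/-- The trace of a power of a Hermitian matrix is the power sum of its eigenvalues. -/
theorem trace_pow_eq_sum_eigenvalues_pow {𝕜 ι : Type*} [RCLike 𝕜] [Fintype ι] [DecidableEq ι]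
    {A : Matrix ι ι 𝕜} (hA : A.IsHermitian) (k : ℕ) :
    (A ^ k).trace = ∑ i, (hA.eigenvalues i : 𝕜) ^ k := by
  conv_lhs => rw [hA.spectral_theorem, ← map_pow, Unitary.conjStarAlgAut_apply, trace_mul_cycle,
    Unitary.coe_star_mul_self, one_mul, diagonal_pow, trace_diagonal]
  simp

end Matrix.IsHermitian

namespace SimpleGraph

variable {V : Type*} [Fintype V] [DecidableEq V] (G : SimpleGraph V) [DecidableRel G.Adj]

/-- Every triangle comes from exactly six ordered triples of pairwise adjacent vertices. -/
theorem card_adj_triples :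
    #{p : V × V × V | G.Adj p.1 p.2.1 ∧ G.Adj p.1 p.2.2 ∧ G.Adj p.2.1 p.2.2} =
      6 * #(G.cliqueFinset 3) := by
  rw [card_eq_sum_card_fiberwise (f := fun p : V × V × V ↦ ({p.1, p.2.1, p.2.2} : Finset V))
    (t := G.cliqueFinset 3), mul_comm, ← smul_eq_mul, ← sum_const]
  · refine sum_congr rfl fun s hs ↦ ?_
    obtain ⟨a, b, c, hab, hac, hbc, rfl⟩ := is3Clique_iff.1 (G.mem_cliqueFinset_iff.1 hs)
    have h : ({p ∈ {p : V × V × V | G.Adj p.1 p.2.1 ∧ G.Adj p.1 p.2.2 ∧ G.Adj p.2.1 p.2.2} |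
        ({p.1, p.2.1, p.2.2} : Finset V) = {a, b, c}} : Finset (V × V × V)) =
        {(a, b, c), (a, c, b), (b, a, c), (b, c, a), (c, a, b), (c, b, a)} := by
      ext ⟨x, y, z⟩
      simp only [mem_filter, mem_univ, true_and, mem_insert, mem_singleton, Prod.mk.injEq]
      constructor
      · rintro ⟨⟨hxy, hxz, hyz⟩, he⟩
        have hx : x ∈ ({a, b, c} : Finset V) := he ▸ by simp
        have hy : y ∈ ({a, b, c} : Finset V) := he ▸ by simp
        have hz : z ∈ ({a, b, c} : Finset V) := he ▸ by simp
        simp only [mem_insert, mem_singleton] at hx hy hz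
        have := hxy.ne
        have := hxz.ne
        have := hyz.ne
        grind
      · have := hab.symm
        have := hac.symm
        have := hbc.symm
        rintro (⟨rfl, rfl, rfl⟩ | ⟨rfl, rfl, rfl⟩ | ⟨rfl, rfl, rfl⟩ | ⟨rfl, rfl, rfl⟩ |
          ⟨rfl, rfl, rfl⟩ | ⟨rfl, rfl, rfl⟩) <;> refine ⟨by tauto, ?_⟩ <;> ext <;> simp <;> tauto
    rw [h]
    have := hab.ne
    have := hac.ne
    have := hbc.ne
    repeat rw [card_insert_of_notMem (by simp; grind)]
    simp
  · rintro ⟨a, b, c⟩ h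
    simpa [is3Clique_triple_iff] using h

/-- The trace of the cube of the adjacency matrix counts every triangle six times. -/
theorem trace_adjMatrix_pow_three (R : Type*) [NonAssocSemiring R] :
    (G.adjMatrix R * (G.adjMatrix R * G.adjMatrix R)).trace = 6 * (#(G.cliqueFinset 3) : R) := by
  have h := congrArg (Nat.cast (R := R)) G.card_adj_triples
  push_cast at h
  rw [← h, card_filter]
  simp only [Fintype.sum_prod_type, trace, diag_apply, mul_apply, adjMatrix_apply]
  push_cast
  refine sum_congr rfl fun a _ ↦ sum_congr rfl fun b _ ↦ ?_
  rw [mul_sum]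
  refine sum_congr rfl fun c _ ↦ ?_
  simp only [G.adj_comm c a]
  split_ifs <;> simp_all

theorem trace_degMatrix_mul_adjMatrix_sq (R : Type*) [NonAssocSemiring R] :
    (G.degMatrix R * (G.adjMatrix R * G.adjMatrix R)).trace =
      ∑ v, (G.degree v : R) * G.degree v := by
  simp only [trace, diag_apply, degMatrix, diagonal_mul, adjMatrix_mul_self_apply_self]

theorem trace_degMatrix_add_adjMatrix (R : Type*) [NonAssocSemiring R] :
    (G.degMatrix R + G.adjMatrix R).trace = ∑ v, (G.degree v : R) := by
  rw [trace_add, trace_adjMatrix, add_zero, degMatrix, trace_diagonal]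

theorem trace_degMatrix_add_adjMatrix_sq (R : Type*) [CommSemiring R] :
    ((G.degMatrix R + G.adjMatrix R) ^ 2).trace =
      ∑ v, (G.degree v : R) ^ 2 + ∑ v, (G.degree v : R) := by
  simp only [trace, diag_apply, ← sum_add_distrib]
  refine sum_congr rfl fun v _ ↦ ?_
  rw [sq, add_mul, mul_add, mul_add]
  simp only [Matrix.add_apply, adjMatrix_mul_self_apply_self, degMatrix, diagonal_mul,
    mul_diagonal, diagonal_apply_eq, adjMatrix_apply, G.irrefl, if_false]
  ring

theorem trace_degMatrix_add_adjMatrix_pow_three (R : Type*) [CommSemiring R] :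
    ((G.degMatrix R + G.adjMatrix R) ^ 3).trace =
      ∑ v, (G.degree v : R) ^ 3 + 3 * ∑ v, (G.degree v : R) ^ 2 + 6 * #(G.cliqueFinset 3) := by
  rw [← trace_adjMatrix_pow_three]
  have hDA := G.trace_degMatrix_mul_adjMatrix_sq R
  have hDDA : (G.degMatrix R * (G.degMatrix R * G.adjMatrix R)).trace = 0 := by
    simp only [trace, diag_apply, degMatrix, diagonal_mul, adjMatrix_apply, G.irrefl, if_false,
      mul_zero, sum_const_zero]
  have hDDD : (G.degMatrix R * (G.degMatrix R * G.degMatrix R)).trace =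
      ∑ v, (G.degree v : R) ^ 3 := by
    simp [degMatrix, trace_diagonal, pow_succ, mul_assoc]
  set D := G.degMatrix R
  set A := G.adjMatrix R
  have h₁ : (D * (A * D)).trace = (D * (D * A)).trace := by
    rw [← mul_assoc, trace_mul_comm]
  have h₂ : (A * (D * D)).trace = (D * (D * A)).trace := by
    rw [trace_mul_comm, mul_assoc]
  have h₃ : (A * (D * A)).trace = (D * (A * A)).trace := by
    rw [trace_mul_comm, mul_assoc]
  have h₄ : (A * (A * D)).trace = (D * (A * A)).trace := by
    rw [← mul_assoc, trace_mul_comm]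
  rw [pow_succ', sq]
  simp only [add_mul, mul_add, trace_add, h₁, h₂, h₃, h₄, hDDA, hDDD, hDA, pow_two]
  ring

theorem dotProduct_mulVec_degMatrix_add_adjMatrix_nonneg (x : V → ℝ) :
    0 ≤ x ⬝ᵥ ((G.degMatrix ℝ + G.adjMatrix ℝ) *ᵥ x) := by
  have hd (v : V) : (G.degree v : ℝ) = ∑ w, if G.Adj v w then 1 else 0 := by
    simp [← card_neighborFinset_eq_degree, neighborFinset_eq_filter]
  have h : 2 * (x ⬝ᵥ ((G.degMatrix ℝ + G.adjMatrix ℝ) *ᵥ x)) =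
      ∑ v, ∑ w, if G.Adj v w then (x v + x w) ^ 2 else 0 := by
    have h₁ : ∑ v, ∑ w, (if G.Adj v w then x v ^ 2 else 0) = ∑ v, G.degree v * x v * x v := by
      refine sum_congr rfl fun v _ ↦ ?_
      rw [hd, mul_assoc, sum_mul]
      refine sum_congr rfl fun w _ ↦ ?_
      split_ifs <;> ring
    have h₂ : ∑ v, ∑ w, (if G.Adj v w then x w ^ 2 else 0) = ∑ v, G.degree v * x v * x v := by
      rw [← h₁, sum_comm]
      simp only [G.adj_comm]
    rw [add_mulVec, dotProduct_add, dotProduct_mulVec_degMatrix, dotProduct_mulVec_adjMatrix,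
      two_mul]
    nth_rewrite 1 [← h₁]
    rw [← h₂]
    simp only [← sum_add_distrib]
    refine sum_congr rfl fun v _ ↦ ?_
    refine sum_congr rfl fun w _ ↦ ?_
    split_ifs <;> ring
  have : 0 ≤ ∑ v, ∑ w, if G.Adj v w then (x v + x w) ^ 2 else 0 :=
    sum_nonneg fun v _ ↦ sum_nonneg fun w _ ↦ by split_ifs <;> positivity
  linarith

theorem posSemidef_degMatrix_add_adjMatrix : (G.degMatrix ℝ + G.adjMatrix ℝ).PosSemidef :=
  .of_dotProduct_mulVec_nonneg ((G.isHermitian_degMatrix ℝ).add (G.isHermitian_adjMatrix ℝ))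
    fun x ↦ by simpa using G.dotProduct_mulVec_degMatrix_add_adjMatrix_nonneg x

end SimpleGraph


/-- For a finite simple graph `G` with `n` vertices, `m` edges and `η`
triangles, the signless Laplacian Estrada index `SLEE(G) = ∑ e^{qᵢ}` (where the `qᵢ` are
the eigenvalues of the signless Laplacian `Q = D + A`) satisfies
`SLEE(G) ≥ n + 3m + η + ∑ dᵢ² + (1/6)·∑ dᵢ³`. -/
theorem stmt_9 (n : ℕ) (G : SimpleGraph (Fin n)) [DecidableRel G.Adj]
    (hQ : (G.degMatrix ℝ + G.adjMatrix ℝ).IsHermitian) :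
    (n : ℝ) + 3 * (G.edgeFinset.card : ℝ) + ((G.cliqueFinset 3).card : ℝ)
        + ∑ i, (G.degree i : ℝ) ^ 2 + (1 / 6) * ∑ i, (G.degree i : ℝ) ^ 3
      ≤ ∑ i, Real.exp (hQ.eigenvalues i) := by
  have hexp (i : Fin n) : 1 + hQ.eigenvalues i + hQ.eigenvalues i ^ 2 / 2 +
      hQ.eigenvalues i ^ 3 / 6 ≤ Real.exp (hQ.eigenvalues i) := by
    have h := Real.sum_le_exp_of_nonneg (G.posSemidef_degMatrix_add_adjMatrix.eigenvalues_nonneg i) 4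
    norm_num [sum_range_succ, Nat.factorial] at h
    linarith
  refine le_trans (le_of_eq ?_) (sum_le_sum fun i _ ↦ hexp i)
  have h₁ := hQ.trace_pow_eq_sum_eigenvalues_pow 1
  have h₂ := hQ.trace_pow_eq_sum_eigenvalues_pow 2
  have h₃ := hQ.trace_pow_eq_sum_eigenvalues_pow 3
  simp only [pow_one, RCLike.ofReal_real_eq_id, id_eq] at h₁ h₂ h₃
  have hm : ∑ i, (G.degree i : ℝ) = 2 * #G.edgeFinset := mod_cast G.sum_degrees_eq_twice_card_edges
  rw [G.trace_degMatrix_add_adjMatrix, hm] at h₁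
  rw [G.trace_degMatrix_add_adjMatrix_sq, hm] at h₂
  rw [G.trace_degMatrix_add_adjMatrix_pow_three] at h₃
  simp only [sum_add_distrib, ← sum_div, ← h₁, ← h₂, ← h₃]
  simp
  ring
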